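/- There exist constants c₁, c₂ > 0 such that for all s > 0 and all f ∈ C_c^∞(ℝ^d): ∫_{ℝ^d} f² dμ ≤ s·D(f,f) + c₁·(1 + s^{-d/α})·Ψ₂( Ψ₁^{-1}(s ∧ c₂) )·( ∫_{ℝ^d} |f| dμ )². -/

import Mathlib

open MeasureTheory

/-- The fractional Dirichlet energy
`D(f,f) = ∫∫ (f(x) − f(y))² / |x − y|^{d+α} dx dy` on `ℝ^d`. -/
noncomputable def fracD (d : ℕ) (α : ℝ) (f : EuclideanSpace ℝ (Fin d) → ℝ) : ℝ :=
  ∫ x, ∫ y, (f x - f y) ^ 2 / ‖x - y‖ ^ ((d : ℝ) + α)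

/-- `Ψ₁(r) = sup_{|x| ≥ r} |x|^α / W(x)`. -/
noncomputable def Psi1 (d : ℕ) (α : ℝ) (W : EuclideanSpace ℝ (Fin d) → ℝ) (r : ℝ) : ℝ :=
  sSup ((fun x => ‖x‖ ^ α / W x) '' {x : EuclideanSpace ℝ (Fin d) | r ≤ ‖x‖})

/-- `Ψ₂(r) = sup_{|x| ≤ r} W(x)²`. -/
noncomputable def Psi2 (d : ℕ) (W : EuclideanSpace ℝ (Fin d) → ℝ) (r : ℝ) : ℝ :=
  sSup ((fun x => (W x) ^ 2) '' {x : EuclideanSpace ℝ (Fin d) | ‖x‖ ≤ r})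

/-- The generalized inverse `Ψ₁⁻¹(t) = inf { r > 0 : Ψ₁(r) ≤ t }`. -/
noncomputable def Psi1Inv (d : ℕ) (α : ℝ) (W : EuclideanSpace ℝ (Fin d) → ℝ) (t : ℝ) : ℝ :=
  sInf {r : ℝ | 0 < r ∧ Psi1 d α W r ≤ t}

lemma kernel_integrable (d : ℕ) (α : ℝ) (hα : α ∈ Set.Ioo (0 : ℝ) 2) (hd : α < d) :
    Integrable (fun h : EuclideanSpace ℝ (Fin d) => min (‖h‖ ^ 2) 1 / ‖h‖ ^ ((d : ℝ) + α)) := by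
  have hd0 : 0 < d := by
    have : (0 : ℝ) < d := lt_trans hα.1 hd
    exact_mod_cast this
  have : Nonempty (Fin d) := ⟨⟨0, hd0⟩⟩
  have key := integrable_fun_norm_addHaar (E := EuclideanSpace ℝ (Fin d)) volume
    (f := fun r : ℝ => min (r ^ 2) 1 / r ^ ((d : ℝ) + α))
  refine key.2 ?_
  rw [finrank_euclideanSpace_fin]
  have hpow : ∀ y : ℝ, 0 < y → y ^ (d - 1) / y ^ ((d : ℝ) + α) = y ^ (-1 - α) := by
    intro y hy
    rw [← Real.rpow_natCast, ← Real.rpow_sub hy]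
    congr 1
    rw [Nat.cast_sub (by omega)]
    push_cast
    ring
  have h1 : IntegrableOn (fun y : ℝ => y ^ (d - 1) • (min (y ^ 2) 1 / y ^ ((d : ℝ) + α)))
      (Set.Ioo 0 2) := by
    have h := ((intervalIntegral.integrableOn_Ioo_rpow_iff (s := 1 - α) (t := 2)
      (by norm_num)).2 (by linarith [hα.2]))
    refine Integrable.mono' h ?_ ?_
    · exact (by fun_prop : Measurable (fun y : ℝ =>
        y ^ (d - 1) • (min (y ^ 2) 1 / y ^ ((d : ℝ) + α)))).aestronglyMeasurable
    · refine ae_restrict_of_forall_mem measurableSet_Ioo fun y hy => ?_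
      have hy0 : 0 < y := hy.1
      rw [Real.norm_of_nonneg (by positivity), smul_eq_mul]
      have : y ^ (1 - α) = y ^ (d - 1) / y ^ ((d : ℝ) + α) * y ^ 2 := by
        rw [hpow y hy0, ← Real.rpow_natCast, ← Real.rpow_add hy0]
        congr 1
        push_cast
        ring
      rw [this]
      have := min_le_left (y ^ 2) 1
      calc _ = y ^ (d - 1) / y ^ ((d : ℝ) + α) * min (y ^ 2) 1 := by ring
        _ ≤ _ := by gcongr
  have h2 : IntegrableOn (fun y : ℝ => y ^ (d - 1) • (min (y ^ 2) 1 / y ^ ((d : ℝ) + α)))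
      (Set.Ioi 1) := by
    have h := integrableOn_Ioi_rpow_of_lt (a := -1 - α) (c := 1) (by linarith [hα.1]) one_pos
    refine Integrable.mono' h ?_ ?_
    · exact (by fun_prop : Measurable (fun y : ℝ =>
        y ^ (d - 1) • (min (y ^ 2) 1 / y ^ ((d : ℝ) + α)))).aestronglyMeasurable
    · refine ae_restrict_of_forall_mem measurableSet_Ioi fun y hy => ?_
      have hy0 : 0 < y := lt_trans one_pos hy
      rw [Real.norm_of_nonneg (by positivity), smul_eq_mul, ← hpow y hy0]
      have := min_le_right (y ^ 2) 1
      calc _ = y ^ (d - 1) / y ^ ((d : ℝ) + α) * min (y ^ 2) 1 := by ring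
        _ ≤ y ^ (d - 1) / y ^ ((d : ℝ) + α) * 1 := by gcongr
        _ = _ := by ring
  refine (h1.union h2).mono_set ?_
  intro y hy
  rcases lt_or_ge y 2 with h | h
  · exact Or.inl ⟨hy, h⟩
  · exact Or.inr (by simp only [Set.mem_Ioi]; linarith)

lemma energy_finite (d : ℕ) (α : ℝ) (hα : α ∈ Set.Ioo (0 : ℝ) 2) (hd : α < d)
    (f : EuclideanSpace ℝ (Fin d) → ℝ) (hf : ContDiff ℝ (⊤ : ℕ∞) f) (hfc : HasCompactSupport f) :
    ∫⁻ x, ∫⁻ y, ENNReal.ofReal ((f x - f y) ^ 2 / ‖x - y‖ ^ ((d : ℝ) + α)) < ⊤ := by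
  have hcont : Continuous f := hf.continuous
  have hmeas : Measurable f := hcont.measurable
  obtain ⟨L, hL⟩ := ContDiff.lipschitzWith_of_hasCompactSupport hfc hf (by simp)
  obtain ⟨M, hM⟩ := hfc.exists_bound_of_continuous hcont
  set K := tsupport f with hK
  have hKc : IsCompact K := hfc
  have hKm : MeasurableSet K := hKc.isClosed.measurableSet
  have hM0 : 0 ≤ M := le_trans (norm_nonneg _) (hM 0)
  set C : ℝ := (L : ℝ) ^ 2 + 4 * M ^ 2 with hC
  have hbound : ∀ x h, (f x - f (x + h)) ^ 2 ≤ C * min (‖h‖ ^ 2) 1 := by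
    intro x h
    have e1 : |f x - f (x + h)| ≤ L * ‖h‖ := by
      have := hL.dist_le_mul x (x + h)
      simpa [Real.dist_eq] using this
    have e2 : |f x - f (x + h)| ≤ 2 * M := by
      have a1 := hM x
      have a2 := hM (x + h)
      have := abs_sub (f x) (f (x + h))
      simp only [Real.norm_eq_abs] at a1 a2
      linarith
    have e3 : (f x - f (x + h)) ^ 2 ≤ (L * ‖h‖) ^ 2 := by
      rw [← sq_abs]; gcongr
    have e4 : (f x - f (x + h)) ^ 2 ≤ (2 * M) ^ 2 := by
      rw [← sq_abs]; gcongr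
    rcases le_total (‖h‖ ^ 2) 1 with hh | hh
    · rw [min_eq_left hh]
      nlinarith [mul_nonneg (sq_nonneg M) (sq_nonneg ‖h‖)]
    · rw [min_eq_right hh]
      nlinarith [sq_nonneg (L : ℝ)]
  have hstep : ∀ x h, ENNReal.ofReal ((f x - f (x + h)) ^ 2 / ‖h‖ ^ ((d : ℝ) + α)) ≤
      ENNReal.ofReal (C * (min (‖h‖ ^ 2) 1 / ‖h‖ ^ ((d : ℝ) + α))) *
        (K.indicator 1 x + K.indicator 1 (x + h)) := by
    intro x h
    by_cases h0 : x ∈ K ∨ x + h ∈ K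
    · have h1 : (1 : ENNReal) ≤ K.indicator 1 x + K.indicator 1 (x + h) := by
        rcases h0 with h0 | h0 <;> simp [h0]
      refine le_trans ?_ (le_mul_of_one_le_right' h1)
      apply ENNReal.ofReal_le_ofReal
      rw [← mul_div_assoc]
      gcongr
      exact hbound x h
    · push Not at h0
      have h1 := image_eq_zero_of_notMem_tsupport h0.1
      have h2 := image_eq_zero_of_notMem_tsupport h0.2
      simp [h1, h2]
  calc ∫⁻ x, ∫⁻ y, ENNReal.ofReal ((f x - f y) ^ 2 / ‖x - y‖ ^ ((d : ℝ) + α))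
      = ∫⁻ x, ∫⁻ h, ENNReal.ofReal ((f x - f (x + h)) ^ 2 / ‖h‖ ^ ((d : ℝ) + α)) := by
        refine lintegral_congr fun x => ?_
        rw [← lintegral_add_left_eq_self _ x]
        simp
    _ ≤ ∫⁻ x, ∫⁻ h, ENNReal.ofReal (C * (min (‖h‖ ^ 2) 1 / ‖h‖ ^ ((d : ℝ) + α))) *
        (K.indicator 1 x + K.indicator 1 (x + h)) := by
        gcongr with x h
        exact hstep x h
    _ = ∫⁻ h, ∫⁻ x, ENNReal.ofReal (C * (min (‖h‖ ^ 2) 1 / ‖h‖ ^ ((d : ℝ) + α))) *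
        (K.indicator 1 x + K.indicator 1 (x + h)) := by
        apply lintegral_lintegral_swap
        have hi : Measurable (K.indicator (1 : EuclideanSpace ℝ (Fin d) → ENNReal)) :=
          measurable_one.indicator hKm
        apply Measurable.aemeasurable
        unfold Function.uncurry
        have m1 : Measurable (fun a : EuclideanSpace ℝ (Fin d) × EuclideanSpace ℝ (Fin d) =>
          K.indicator (1 : EuclideanSpace ℝ (Fin d) → ENNReal) a.1) := hi.comp measurable_fst
        have m2 : Measurable (fun a : EuclideanSpace ℝ (Fin d) × EuclideanSpace ℝ (Fin d) =>
          K.indicator (1 : EuclideanSpace ℝ (Fin d) → ENNReal) (a.1 + a.2)) :=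
            hi.comp (measurable_fst.add measurable_snd)
        refine Measurable.mul ?_ (m1.add m2)
        fun_prop
    _ = ∫⁻ h, ENNReal.ofReal (C * (min (‖h‖ ^ 2) 1 / ‖h‖ ^ ((d : ℝ) + α))) *
        (volume K + volume K) := by
        refine lintegral_congr fun h => ?_
        rw [lintegral_const_mul' _ _ ENNReal.ofReal_ne_top,
          lintegral_add_left (measurable_one.indicator hKm),
          lintegral_add_right_eq_self (K.indicator 1) h, lintegral_indicator_one hKm]
    _ = (∫⁻ h : EuclideanSpace ℝ (Fin d), ENNReal.ofReal (C * (min (‖h‖ ^ 2) 1 /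
          ‖h‖ ^ ((d : ℝ) + α)))) * (volume K + volume K) := by
        rw [lintegral_mul_const']
        exact ENNReal.add_ne_top.2 ⟨hKc.measure_lt_top.ne, hKc.measure_lt_top.ne⟩
    _ < ⊤ := by
        refine ENNReal.mul_lt_top ?_ (ENNReal.add_lt_top.2 ⟨hKc.measure_lt_top, hKc.measure_lt_top⟩)
        have := ((kernel_integrable d α hα hd).const_mul C)
        exact (hasFiniteIntegral_iff_ofReal (by filter_upwards with h; positivity)).1 this.2

lemma fracD_eq (d : ℕ) (α : ℝ) (hα : α ∈ Set.Ioo (0 : ℝ) 2) (hd : α < d)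
    (f : EuclideanSpace ℝ (Fin d) → ℝ) (hf : ContDiff ℝ (⊤ : ℕ∞) f) (hfc : HasCompactSupport f) :
    ENNReal.ofReal (fracD d α f) =
      ∫⁻ x, ∫⁻ y, ENNReal.ofReal ((f x - f y) ^ 2 / ‖x - y‖ ^ ((d : ℝ) + α)) := by
  have hfin := energy_finite d α hα hd f hf hfc
  have hmeas : Measurable f := hf.continuous.measurable
  have hm : Measurable (fun z : EuclideanSpace ℝ (Fin d) × EuclideanSpace ℝ (Fin d) =>
      (f z.1 - f z.2) ^ 2 / ‖z.1 - z.2‖ ^ ((d : ℝ) + α)) := by fun_prop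
  have hnn : ∀ z : EuclideanSpace ℝ (Fin d) × EuclideanSpace ℝ (Fin d),
      0 ≤ (f z.1 - f z.2) ^ 2 / ‖z.1 - z.2‖ ^ ((d : ℝ) + α) := fun z => by positivity
  have hl := lintegral_prod (μ := (volume : Measure (EuclideanSpace ℝ (Fin d))))
    (ν := (volume : Measure (EuclideanSpace ℝ (Fin d)))) _ hm.ennreal_ofReal.aemeasurable
  have hint : Integrable (fun z : EuclideanSpace ℝ (Fin d) × EuclideanSpace ℝ (Fin d) =>
      (f z.1 - f z.2) ^ 2 / ‖z.1 - z.2‖ ^ ((d : ℝ) + α)) (volume.prod volume) := by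
    refine ⟨hm.aestronglyMeasurable, ?_⟩
    rw [hasFiniteIntegral_iff_ofReal (by filter_upwards with z; exact hnn z), hl]
    exact hfin
  unfold fracD
  rw [← hl, ← ofReal_integral_eq_lintegral_ofReal hint (by filter_upwards with z; exact hnn z),
    integral_prod _ hint]

lemma sobolev_pointwise (d : ℕ) (α p : ℝ) (hα : α ∈ Set.Ioo (0 : ℝ) 2) (hd : α < d)
    (hp : p = 2 * d / (d - α)) :
    ∃ C > (0 : ℝ), ∀ f : EuclideanSpace ℝ (Fin d) → ℝ, Continuous f → ∀ N : ℝ, 0 < N →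
      ∫⁻ x, ENNReal.ofReal (|f x| ^ p) = ENNReal.ofReal N → ∀ x,
        ENNReal.ofReal (|f x| ^ p) ≤ ENNReal.ofReal (C * N ^ (α / d)) *
          ∫⁻ y, ENNReal.ofReal ((f x - f y) ^ 2 / ‖x - y‖ ^ ((d : ℝ) + α)) := by
  have hdR : (0 : ℝ) < d := lt_trans hα.1 hd
  have hd0 : 0 < d := by exact_mod_cast hdR
  have : Nonempty (Fin d) := ⟨⟨0, hd0⟩⟩
  have hda : 0 < (d : ℝ) - α := by linarith
  have hp0 : 0 < p := by rw [hp]; positivity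
  have hpe : 2 + p * (α / d) = p := by rw [hp]; field_simp; ring
  set B := Metric.ball (0 : EuclideanSpace ℝ (Fin d)) 1 with hB
  set ω : ℝ := (volume B).toReal with hω
  have hBfin : volume B ≠ ⊤ := measure_ball_lt_top.ne
  have hω0 : 0 < ω := ENNReal.toReal_pos (Metric.measure_ball_pos _ _ one_pos).ne' hBfin
  have hBω : volume B = ENNReal.ofReal ω := (ENNReal.ofReal_toReal hBfin).symm
  refine ⟨8 / ω * (2 ^ (p + 1) / ω) ^ (α / d), by positivity, ?_⟩
  intro f hf N hN hNeq x
  by_cases hx : f x = 0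
  · simp [hx, Real.zero_rpow hp0.ne']
  set a := |f x| with ha
  have ha0 : 0 < a := abs_pos.2 hx
  set V : ℝ := 2 ^ (p + 1) * N / a ^ p with hV
  have hV0 : 0 < V := by positivity
  set r : ℝ := (V / ω) ^ (1 / (d : ℝ)) with hr
  have hr0 : 0 < r := by positivity
  have hrd : r ^ d = V / ω := by
    rw [hr, ← Real.rpow_natCast, ← Real.rpow_mul (by positivity)]
    rw [one_div, inv_mul_cancel₀ hdR.ne', Real.rpow_one]
  have hrα : r ^ α = (V / ω) ^ (α / d) := by
    rw [hr, ← Real.rpow_mul (by positivity)]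
    congr 1; ring
  have hball : volume (Metric.ball x r) = ENNReal.ofReal V := by
    rw [Measure.addHaar_ball _ _ hr0.le, finrank_euclideanSpace_fin, ← hB, hBω,
      ← ENNReal.ofReal_mul (by positivity), hrd]
    congr 1; field_simp
  set T : Set (EuclideanSpace ℝ (Fin d)) := {y | a / 2 ≤ |f y|} with hT
  have hTm : MeasurableSet T := measurableSet_le measurable_const (by fun_prop)
  have hTvol : volume T ≤ ENNReal.ofReal (V / 2) := by
    have hm : AEMeasurable (fun y => ENNReal.ofReal (|f y| ^ p)) volume := by
      have := hf.measurable
      fun_prop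
    have h1 := meas_ge_le_lintegral_div hm (ε := ENNReal.ofReal ((a / 2) ^ p))
      (by rw [Ne, ENNReal.ofReal_eq_zero, not_le]; positivity) ENNReal.ofReal_ne_top
    rw [hNeq, ← ENNReal.ofReal_div_of_pos (by positivity)] at h1
    have h2 : N / (a / 2) ^ p = V / 2 := by
      rw [hV, Real.div_rpow ha0.le (by norm_num), Real.rpow_add (by norm_num), Real.rpow_one]
      field_simp
    rw [h2] at h1
    refine le_trans (measure_mono ?_) h1
    intro y hy
    apply ENNReal.ofReal_le_ofReal
    exact Real.rpow_le_rpow (by positivity) hy hp0.le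
  have hSvol : ENNReal.ofReal (V / 2) ≤ volume (Metric.ball x r \ T) := by
    refine le_trans ?_ le_measure_sdiff
    rw [hball]
    calc ENNReal.ofReal (V / 2) = ENNReal.ofReal V - ENNReal.ofReal (V / 2) := by
          rw [← ENNReal.ofReal_sub _ (by positivity)]; congr 1; ring
      _ ≤ _ := tsub_le_tsub_left hTvol _
  have hG : ENNReal.ofReal ((a / 2) ^ 2 / r ^ ((d : ℝ) + α)) * ENNReal.ofReal (V / 2) ≤
      ∫⁻ y, ENNReal.ofReal ((f x - f y) ^ 2 / ‖x - y‖ ^ ((d : ℝ) + α)) := by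
    calc _ ≤ ENNReal.ofReal ((a / 2) ^ 2 / r ^ ((d : ℝ) + α)) * volume (Metric.ball x r \ T) := by
          gcongr
      _ = ∫⁻ y in Metric.ball x r \ T, ENNReal.ofReal ((a / 2) ^ 2 / r ^ ((d : ℝ) + α)) := by
          rw [setLIntegral_const]
      _ ≤ ∫⁻ y in Metric.ball x r \ T,
            ENNReal.ofReal ((f x - f y) ^ 2 / ‖x - y‖ ^ ((d : ℝ) + α)) := by
          refine setLIntegral_mono' (measurableSet_ball.diff hTm) fun y hy => ?_
          apply ENNReal.ofReal_le_ofReal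
          have hy1 : ‖x - y‖ < r := by
            have := hy.1
            rwa [Metric.mem_ball, dist_comm, dist_eq_norm] at this
          have hy2 : |f y| < a / 2 := not_le.1 hy.2
          have hne : x ≠ y := by
            rintro rfl
            linarith
          have hpos : 0 < ‖x - y‖ := norm_pos_iff.2 (sub_ne_zero.2 hne)
          have hsq : (a / 2) ^ 2 ≤ (f x - f y) ^ 2 := by
            rw [← sq_abs (f x - f y)]
            have := abs_sub_abs_le_abs_sub (f x) (f y)
            gcongr
            linarith
          have hα1 := hα.1
          gcongr
      _ ≤ _ := setLIntegral_le_lintegral _ _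
  refine le_trans ?_ (mul_le_mul_right hG _)
  rw [← ENNReal.ofReal_mul (by positivity), ← ENNReal.ofReal_mul (by positivity)]
  apply ENNReal.ofReal_le_ofReal
  apply le_of_eq
  have e1 : (2 ^ (p + 1) / ω) ^ (α / d) * N ^ (α / d) = (V / ω) ^ (α / d) * a ^ (p * (α / d)) := by
    rw [← Real.mul_rpow (by positivity) (by positivity), Real.rpow_mul ha0.le,
      ← Real.mul_rpow (by positivity) (by positivity)]
    congr 1
    rw [hV]; field_simp
  have e2 : a ^ p = a ^ 2 * a ^ (p * (α / d)) := by
    rw [← Real.rpow_natCast a 2, ← Real.rpow_add ha0]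
    push_cast
    rw [hpe]
  rw [Real.rpow_add hr0, Real.rpow_natCast, hrd, hrα, mul_assoc (8 / ω), e1, e2]
  have hq : 0 < (V / ω) ^ (α / d) := by positivity
  field_simp
  norm_num

lemma integrable_pow (d : ℕ) (p : ℝ) (hp : 0 < p)
    (f : EuclideanSpace ℝ (Fin d) → ℝ) (hf : Continuous f) (hfc : HasCompactSupport f) :
    Integrable (fun x => |f x| ^ p) := by
  apply Continuous.integrable_of_hasCompactSupport
  · exact hf.abs.rpow_const fun x => Or.inr hp.le
  · exact hfc.comp_left (g := fun t : ℝ => |t| ^ p) (by simp [Real.zero_rpow hp.ne'])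

lemma fracD_nonneg (d : ℕ) (α : ℝ) (f : EuclideanSpace ℝ (Fin d) → ℝ) : 0 ≤ fracD d α f :=
  integral_nonneg fun x => integral_nonneg fun y => by positivity

lemma sobolev (d : ℕ) (α p : ℝ) (hα : α ∈ Set.Ioo (0 : ℝ) 2) (hd : α < d)
    (hp : p = 2 * d / (d - α)) :
    ∃ C > (0 : ℝ), ∀ f : EuclideanSpace ℝ (Fin d) → ℝ, ContDiff ℝ (⊤ : ℕ∞) f →
      HasCompactSupport f → ∫ x, |f x| ^ p ≤ (C * fracD d α f) ^ (p / 2) := by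
  have hdR : (0 : ℝ) < d := lt_trans hα.1 hd
  have hda : 0 < (d : ℝ) - α := by linarith
  have hp0 : 0 < p := by rw [hp]; positivity
  obtain ⟨C, hC, h⟩ := sobolev_pointwise d α p hα hd hp
  refine ⟨C, hC, fun f hf hfc => ?_⟩
  have hint := integrable_pow d p hp0 f hf.continuous hfc
  have hD := fracD_nonneg d α f
  set N := ∫ x, |f x| ^ p with hN
  have hN0 : 0 ≤ N := integral_nonneg fun x => by positivity
  have hNl := ofReal_integral_eq_lintegral_ofReal hint
    (by filter_upwards with x; positivity)
  rcases hN0.eq_or_lt with hz | hpos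
  · rw [← hz]; positivity
  have key : ENNReal.ofReal N ≤ ENNReal.ofReal (C * N ^ (α / d) * fracD d α f) := by
    rw [ENNReal.ofReal_mul (by positivity), fracD_eq d α hα hd f hf hfc,
      ← lintegral_const_mul' _ _ ENNReal.ofReal_ne_top, hNl]
    exact lintegral_mono (h f hf.continuous N hpos hNl.symm)
  rw [ENNReal.ofReal_le_ofReal_iff (by positivity)] at key
  have h1 : N ^ (1 - α / d) ≤ C * fracD d α f := by
    rw [Real.rpow_sub hpos, Real.rpow_one, div_le_iff₀ (by positivity)]
    linarith
  calc N = (N ^ (1 - α / d)) ^ (p / 2) := by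
        rw [← Real.rpow_mul hN0]
        have : (1 - α / d) * (p / 2) = 1 := by rw [hp]; field_simp
        rw [this, Real.rpow_one]
    _ ≤ _ := by gcongr

lemma weighted_nash (d : ℕ) (α : ℝ) (hα : α ∈ Set.Ioo (0 : ℝ) 2) (hd : α < d)
    (W : EuclideanSpace ℝ (Fin d) → ℝ) (hWmeas : Measurable W)
    (hW1 : ∀ x, 1 ≤ W x) :
    ∃ c₁ > (0 : ℝ), ∀ s : ℝ, 0 < s →
      ∀ f : EuclideanSpace ℝ (Fin d) → ℝ, ContDiff ℝ (⊤ : ℕ∞) f → HasCompactSupport f →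
        ∫ x, (f x) ^ 2 * (W x)⁻¹ ≤
          s * fracD d α f + c₁ * s ^ (-(d : ℝ) / α) * (∫ x, |f x| * (W x)⁻¹) ^ 2 := by
  have hα0 := hα.1
  have hdR : (0 : ℝ) < d := lt_trans hα.1 hd
  have hda : 0 < (d : ℝ) - α := by linarith
  set p : ℝ := 2 * d / (d - α) with hp
  have hp2 : 0 < p - 2 := by
    have : p - 2 = 2 * α / (d - α) := by rw [hp]; field_simp; ring
    rw [this]; positivity
  obtain ⟨C, hC, hS⟩ := sobolev d α p hα hd hp
  set C' : ℝ := C ^ (p / 2) with hC'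
  have hC'0 : 0 < C' := by positivity
  set K : ℝ := (2 * C') ^ (1 / (p - 2)) with hK
  have hK0 : 0 < K := by positivity
  refine ⟨K ^ 2 / 2, by positivity, fun s hs f hf hfc => ?_⟩
  have hWinv : ∀ x, (W x)⁻¹ ≤ 1 := fun x => inv_le_one_of_one_le₀ (hW1 x)
  have hWinv0 : ∀ x, 0 ≤ (W x)⁻¹ := fun x => inv_nonneg.2 (by linarith [hW1 x])
  have hint := integrable_pow d p (by linarith) f hf.continuous hfc
  have hmul : ∀ g : EuclideanSpace ℝ (Fin d) → ℝ, Integrable g →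
      Integrable (fun x => g x * (W x)⁻¹) := by
    intro g hg
    refine hg.mul_bdd (c := 1) hWmeas.inv.aestronglyMeasurable ?_
    filter_upwards with x
    rw [Real.norm_of_nonneg (hWinv0 x)]
    exact hWinv x
  have hiA : Integrable (fun x => |f x| * (W x)⁻¹) :=
    hmul _ (hf.continuous.integrable_of_hasCompactSupport hfc).abs
  set A := ∫ x, |f x| * (W x)⁻¹ with hA
  have hA0 : 0 ≤ A := integral_nonneg fun x => mul_nonneg (abs_nonneg _) (hWinv0 x)
  have hD0 := fracD_nonneg d α f
  have split : ∀ t : ℝ, 0 < t →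
      ∫ x, (f x) ^ 2 * (W x)⁻¹ ≤ t * A + t ^ (2 - p) * ∫ x, |f x| ^ p := by
    intro t ht
    rw [hA, ← integral_const_mul, ← integral_const_mul, ← integral_add
      (hiA.const_mul t) (hint.const_mul _)]
    refine integral_mono_of_nonneg ?_ ((hiA.const_mul t).add (hint.const_mul _)) ?_
    · filter_upwards with x
      exact mul_nonneg (sq_nonneg _) (hWinv0 x)
    · filter_upwards with x
      have hw0 := hWinv0 x
      have hw1 := hWinv x
      rw [← sq_abs (f x)]
      rcases le_or_gt (|f x|) t with hle | hlt
      · have e : |f x| ^ 2 * (W x)⁻¹ ≤ t * (|f x| * (W x)⁻¹) := by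
          calc _ = |f x| * (|f x| * (W x)⁻¹) := by ring
            _ ≤ _ := by gcongr
        have : 0 ≤ t ^ (2 - p) * |f x| ^ p := by positivity
        linarith
      · have hfx : 0 < |f x| := ht.trans hlt
        have e : |f x| ^ 2 ≤ t ^ (2 - p) * |f x| ^ p := by
          have h1 : |f x| ^ (2 - p) ≤ t ^ (2 - p) :=
            Real.rpow_le_rpow_of_nonpos ht hlt.le (by linarith)
          calc |f x| ^ 2 = |f x| ^ (2 - p) * |f x| ^ p := by
                rw [← Real.rpow_add hfx, ← Real.rpow_natCast]
                congr 1; push_cast; ring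
            _ ≤ _ := by gcongr
        have e2 : |f x| ^ 2 * (W x)⁻¹ ≤ |f x| ^ 2 := mul_le_of_le_one_right (by positivity) hw1
        have : 0 ≤ t * (|f x| * (W x)⁻¹) := by positivity
        linarith
  have main : ∀ D : ℝ, 0 < D → fracD d α f ≤ D →
      ∫ x, (f x) ^ 2 * (W x)⁻¹ ≤ s * D + K ^ 2 / 2 * s ^ (-(d : ℝ) / α) * A ^ 2 := by
    intro D hD hle
    have hN : ∫ x, |f x| ^ p ≤ C' * D ^ (p / 2) := by
      refine (hS f hf hfc).trans ?_
      rw [hC', ← Real.mul_rpow hC.le hD.le]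
      gcongr
    set u : ℝ := s ^ (-1 / (p - 2)) with hu
    have hu0 : 0 < u := by positivity
    set t : ℝ := K * D ^ (1 / 2 : ℝ) * u with ht
    have ht0 : 0 < t := by positivity
    have e1 : t ^ (2 - p) = (2 * C')⁻¹ * D ^ (1 - p / 2) * s := by
      rw [ht, Real.mul_rpow (by positivity) (by positivity),
        Real.mul_rpow (by positivity) (by positivity), hK, hu,
        ← Real.rpow_mul (by positivity), ← Real.rpow_mul (by positivity),
        ← Real.rpow_mul (by positivity)]
      have a1 : 1 / (p - 2) * (2 - p) = -1 := by field_simp; ring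
      have a2 : -1 / (p - 2) * (2 - p) = 1 := by field_simp; ring
      have a3 : 1 / 2 * (2 - p) = 1 - p / 2 := by ring
      rw [a1, a2, a3, Real.rpow_one, Real.rpow_neg_one]
    have e2 : t ^ (2 - p) * (C' * D ^ (p / 2)) = s * D / 2 := by
      have : D ^ (1 - p / 2) * D ^ (p / 2) = D := by
        rw [← Real.rpow_add hD]; simp
      rw [e1]
      calc _ = (2 * C')⁻¹ * C' * s * (D ^ (1 - p / 2) * D ^ (p / 2)) := by ring
        _ = _ := by rw [this]; field_simp
    have e3 : u ^ 2 = s * s ^ (-(d : ℝ) / α) := by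
      rw [hu, ← Real.rpow_natCast, ← Real.rpow_mul hs.le]
      nth_rewrite 2 [← Real.rpow_one s]
      rw [← Real.rpow_add hs]
      congr 1
      have : p - 2 = 2 * α / (d - α) := by rw [hp]; field_simp; ring
      rw [this]; push_cast; field_simp; ring
    have e4 : (D ^ (1 / 2 : ℝ)) ^ 2 = D := by
      rw [← Real.rpow_natCast, ← Real.rpow_mul hD.le]; norm_num
    set v : ℝ := s ^ (-(d : ℝ) / α) with hv
    have hv0 : 0 < v := by positivity
    have e5 : t * A ≤ s * D / 2 + K ^ 2 / 2 * v * A ^ 2 := by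
      have h1 : (t * A) ^ 2 = 4 * (s * D / 2) * (K ^ 2 / 2 * v * A ^ 2) := by
        calc (t * A) ^ 2 = K ^ 2 * (D ^ (1 / 2 : ℝ)) ^ 2 * u ^ 2 * A ^ 2 := by rw [ht]; ring
          _ = _ := by rw [e3, e4]; ring
      have h2 : 0 ≤ s * D / 2 := by positivity
      have h3 : 0 ≤ K ^ 2 / 2 * v * A ^ 2 := by positivity
      refine abs_le_of_sq_le_sq' ?_ (by positivity) |>.2
      nlinarith [sq_nonneg (s * D / 2 - K ^ 2 / 2 * v * A ^ 2)]
    have e6 : t ^ (2 - p) * ∫ x, |f x| ^ p ≤ s * D / 2 := by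
      rw [← e2]; gcongr
    have := split t ht0
    linarith
  refine le_of_forall_pos_le_add fun ε hε => ?_
  have := main (fracD d α f + ε / s) (by positivity) (by linarith [div_pos hε hs])
  have e : s * (fracD d α f + ε / s) = s * fracD d α f + ε := by field_simp
  linarith

theorem super_poincare_L1mu
    (d : ℕ) (α : ℝ) (hα : α ∈ Set.Ioo (0 : ℝ) 2) (hd : α < d)
    (W : EuclideanSpace ℝ (Fin d) → ℝ) (hWmeas : Measurable W)
    (hW1 : ∀ x, 1 ≤ W x)
    (hWloc : ∀ r : ℝ, BddAbove (W '' {x : EuclideanSpace ℝ (Fin d) | ‖x‖ ≤ r}))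
    (hPsi1 : Filter.Tendsto (Psi1 d α W) Filter.atTop (nhds 0)) :
    ∃ c₁ > (0 : ℝ), ∃ c₂ > (0 : ℝ), ∀ s : ℝ, 0 < s →
      ∀ f : EuclideanSpace ℝ (Fin d) → ℝ, ContDiff ℝ (⊤ : ℕ∞) f → HasCompactSupport f →
        ∫ x, (f x) ^ 2 * (W x)⁻¹ ≤
          s * fracD d α f
            + c₁ * (1 + s ^ (-(d : ℝ) / α)) * Psi2 d W (Psi1Inv d α W (min s c₂)) *
                (∫ x, |f x| * (W x)⁻¹) ^ 2 := by

  obtain ⟨c₁, hc₁, h⟩ := weighted_nash d α hα hd W hWmeas hW1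
  refine ⟨c₁, hc₁, 1, one_pos, fun s hs f hf hfc => (h s hs f hf hfc).trans ?_⟩
  set R := Psi1Inv d α W (min s 1) with hR
  have hR0 : 0 ≤ R := Real.sInf_nonneg fun r hr => hr.1.le
  have hPsi : 1 ≤ Psi2 d W R := by
    have hb : BddAbove ((fun x => (W x) ^ 2) '' {x : EuclideanSpace ℝ (Fin d) | ‖x‖ ≤ R}) := by
      obtain ⟨M, hM⟩ := hWloc R
      refine ⟨M ^ 2, ?_⟩
      rintro _ ⟨x, hx, rfl⟩
      have h1 := hM ⟨x, hx, rfl⟩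
      have h2 := hW1 x
      have : 0 ≤ W x := by linarith
      simp only
      gcongr
    refine le_trans ?_ (le_csSup hb ⟨0, by simpa using hR0, rfl⟩)
    have := hW1 0
    simp only
    nlinarith
  have hsp : 0 < s ^ (-(d : ℝ) / α) := by positivity
  refine add_le_add le_rfl (mul_le_mul_of_nonneg_right ?_ (sq_nonneg _))
  calc c₁ * s ^ (-(d : ℝ) / α) ≤ c₁ * (1 + s ^ (-(d : ℝ) / α)) := by gcongr; linarith
    _ ≤ _ := le_mul_of_one_le_right (by positivity) hPsi
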